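/- Let n ≥ 5 and let M be an edge set of the complete graph K_n such that the subgraph K_n[M] induced by the edges of M is the vertex-disjoint union of a path P_3 on 3 vertices and a single edge P_2. Then κ_3(K_n \ M) = n − 3. -/

import Mathlib

open SimpleGraph

/-- Trees `T 0, …, T (r-1)` are internally disjoint `S`-trees in `G`: each `T i` is a
subgraph of `G` that is a tree containing every vertex of `S`, the edge sets are pairwise
disjoint, and the vertex sets of any two distinct trees intersect exactly in `S`. -/
def IsInternallyDisjointSTrees {V : Type*} (G : SimpleGraph V) (S : Set V) {r : ℕ}
    (T : Fin r → G.Subgraph) : Prop :=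
  (∀ i, S ⊆ (T i).verts ∧ (T i).coe.IsTree) ∧
  Pairwise fun i j =>
    Disjoint (T i).edgeSet (T j).edgeSet ∧ (T i).verts ∩ (T j).verts = S

/-- The generalized `k`-connectivity `κ_k(G)`: the greatest positive integer `r` such that
for every set `S` of `k` vertices there are `r` internally disjoint `S`-trees in `G`. -/
noncomputable def genConn {V : Type*} (G : SimpleGraph V) (k : ℕ) : ℕ :=
  sSup {r : ℕ | 0 < r ∧ ∀ S : Finset V, S.card = k →
    ∃ T : Fin r → G.Subgraph, IsInternallyDisjointSTrees G (↑S) T}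

/-- `M` forms a path on 4 vertices `a - b - c - d`. -/
def IsP4Edges {V : Type*} (M : Set (Sym2 V)) : Prop :=
  ∃ a b c d : V, [a, b, c, d].Nodup ∧ M = {s(a, b), s(b, c), s(c, d)}

/-- `M` forms the vertex-disjoint union of a path on 3 vertices `a - b - c`
and a single edge `d - e`. -/
def IsP3UnionP2Edges {V : Type*} (M : Set (Sym2 V)) : Prop :=
  ∃ a b c d e : V, [a, b, c, d, e].Nodup ∧ M = {s(a, b), s(b, c), s(d, e)}

/-- `M` forms the vertex-disjoint union of a triangle on `a, b, c`
and a single edge `d - e`. -/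
def IsC3UnionP2Edges {V : Type*} (M : Set (Sym2 V)) : Prop :=
  ∃ a b c d e : V, [a, b, c, d, e].Nodup ∧ M = {s(a, b), s(b, c), s(a, c), s(d, e)}

/-- `M` is a matching: no two distinct members of `M` share a vertex. -/
def IsMatchingEdges {V : Type*} (M : Set (Sym2 V)) : Prop :=
  M.Pairwise fun e f => ∀ v : V, v ∈ e → v ∉ f

/-- A connected subgraph contains a subgraph on the same vertices that is a tree. -/
theorem SimpleGraph.Subgraph.Connected.exists_isTree_le {V : Type*} [Finite V]
    {G : SimpleGraph V} {H : G.Subgraph} (hH : H.Connected) :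
    ∃ T ≤ H, T.verts = H.verts ∧ T.coe.IsTree := by
  obtain ⟨T, hle, hT⟩ := hH.coe.exists_isTree_le
  let K : G.Subgraph :=
    { verts := H.verts
      Adj := fun u v => ∃ (hu : u ∈ H.verts) (hv : v ∈ H.verts), T.Adj ⟨u, hu⟩ ⟨v, hv⟩
      adj_sub := fun ⟨_, _, h⟩ => H.adj_sub (hle h)
      edge_vert := fun ⟨hu, _, _⟩ => hu
      symm := ⟨fun _ _ ⟨hu, hv, h⟩ => ⟨hv, hu, h.symm⟩⟩ }
  have hK : K.coe = T := by
    ext ⟨u, hu⟩ ⟨v, hv⟩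
    exact ⟨fun ⟨_, _, h⟩ => h, fun h => ⟨hu, hv, h⟩⟩
  exact ⟨K, ⟨le_rfl, fun _ _ ⟨_, _, h⟩ => hle h⟩, rfl, hK ▸ hT⟩

/-- Connected subgraphs `H v` on `S ∪ {v}`, one for each vertex `v` outside `S`, whose edges
inside `S` are pairwise disjoint, yield `|V \ S|` internally disjoint `S`-trees. -/
theorem exists_isInternallyDisjointSTrees {V : Type*} [Fintype V] {G : SimpleGraph V}
    {S : Finset V} {r : ℕ} (hr : Fintype.card V - S.card = r) (I : V → Set (Sym2 V))
    (hI : ∀ u ∉ S, ∀ v ∉ S, u ≠ v → Disjoint (I u) (I v))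
    (hH : ∀ v ∉ S, ∃ H : G.Subgraph, H.Connected ∧ H.verts = insert v (S : Set V) ∧
      ∀ e ∈ H.edgeSet, v ∈ e ∨ e ∈ I v) :
    ∃ T : Fin r → G.Subgraph, IsInternallyDisjointSTrees G (S : Set V) T := by
  classical
  have hT : ∀ v : {v // v ∉ S}, ∃ T : G.Subgraph, T.coe.IsTree ∧
      T.verts = insert v.1 (S : Set V) ∧ ∀ e ∈ T.edgeSet, v.1 ∈ e ∨ e ∈ I v := by
    rintro ⟨v, hv⟩
    obtain ⟨H, hc, hverts, he⟩ := hH v hv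
    obtain ⟨T, hle, hTv, hT⟩ := hc.exists_isTree_le
    exact ⟨T, hT, hTv.trans hverts, fun e h => he e (Subgraph.edgeSet_mono hle h)⟩
  choose T htree hverts hedge using hT
  have hcard : Fintype.card {v // v ∉ S} = r := by
    rw [Fintype.card_subtype_compl, Fintype.card_coe, hr]
  let f := (Fintype.equivFinOfCardEq hcard).symm
  have key : ∀ u v : {v // v ∉ S}, u ≠ v → ∀ e ∈ (T v).edgeSet, u.1 ∉ e := by
    intro u v huv e he hu
    have hmem := Subgraph.mem_verts_of_mem_edge he hu
    rw [hverts] at hmem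
    rcases hmem with h | h
    · exact huv (Subtype.ext h)
    · exact u.2 h
  refine ⟨fun i => T (f i), fun i => ⟨?_, htree _⟩, fun i j hij => ?_⟩
  · rw [hverts]
    exact Set.subset_insert _ _
  · have hne : f i ≠ f j := f.injective.ne hij
    constructor
    · rw [Set.disjoint_left]
      intro e hi hj
      rcases hedge _ e hi with h | h
      · exact key _ _ hne e hj h
      rcases hedge _ e hj with h' | h'
      · exact key _ _ hne.symm e hi h'
      · exact Set.disjoint_left.1
          (hI _ (f i).2 _ (f j).2 fun h => hne (Subtype.ext h)) h h'
    · rw [hverts, hverts]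
      ext w
      have hne' : (f i).1 ≠ (f j).1 := fun h => hne (Subtype.ext h)
      have := (f i).2
      have := (f j).2
      simp only [Set.mem_inter_iff, Set.mem_insert_iff, SetLike.mem_coe]
      grind

/-- Three edges, each meeting the union of the previous ones, form a connected subgraph. -/
theorem connected_sup_subgraphOfAdj {V : Type*} {G : SimpleGraph V} {a b c d e f : V}
    (h₁ : G.Adj a b) (h₂ : G.Adj c d) (h₃ : G.Adj e f) (hc : c = a ∨ c = b)
    (he : e = a ∨ e = b ∨ e = d) :
    (G.subgraphOfAdj h₁ ⊔ G.subgraphOfAdj h₂ ⊔ G.subgraphOfAdj h₃).Connected := by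
  refine Subgraph.connected_sup ?_ (Subgraph.subgraphOfAdj_connected h₃).preconnected ⟨e, ?_⟩
  · refine (Subgraph.connected_sup (Subgraph.subgraphOfAdj_connected h₁).preconnected
      (Subgraph.subgraphOfAdj_connected h₂).preconnected ⟨c, ?_⟩).preconnected
    simp [hc]
  · simp only [Subgraph.verts_inf, Subgraph.verts_sup, subgraphOfAdj_verts, Set.mem_inter_iff,
      Set.mem_union, Set.mem_insert_iff, Set.mem_singleton_iff]
    grind

/-- A sufficient condition for `|V| - 3` internally disjoint trees on `{x, y, z}`: every other
vertex is adjacent to all of `x, y, z`, or repairs its missing edges by edges of the triangle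
`x y z`, where `xy`, `yz`, `xz` are reserved for the vertices `p`, `q`, `r` respectively. -/
theorem exists_isInternallyDisjointSTrees_triple {V : Type*} [Fintype V] [DecidableEq V]
    {G : SimpleGraph V} {x y z : V} (hxy : x ≠ y) (hyz : y ≠ z) (hxz : x ≠ z) (p q r : V)
    (h : ∀ v, v ≠ x → v ≠ y → v ≠ z →
      (G.Adj v x ∧ G.Adj v y ∧ G.Adj v z) ∨
      (v = p ∧ G.Adj x y ∧ G.Adj v z ∧ (G.Adj v x ∨ G.Adj v y)) ∨
      (v = q ∧ G.Adj y z ∧ G.Adj v x ∧ (G.Adj v y ∨ G.Adj v z)) ∨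
      (v = r ∧ G.Adj x z ∧ G.Adj v y ∧ (G.Adj v x ∨ G.Adj v z)) ∨
      (v = p ∧ v = q ∧ G.Adj x y ∧ G.Adj y z ∧ G.Adj v z)) :
    ∃ T : Fin (Fintype.card V - 3) → G.Subgraph,
      IsInternallyDisjointSTrees G (({x, y, z} : Finset V) : Set V) T := by
  have hcard : ({x, y, z} : Finset V).card = 3 :=
    Finset.card_eq_three.2 ⟨x, y, z, hxy, hxz, hyz, rfl⟩
  refine exists_isInternallyDisjointSTrees (by rw [hcard])
    (fun v => {e | e = s(x, y) ∧ v = p ∨ e = s(y, z) ∧ v = q ∨ e = s(x, z) ∧ v = r}) ?_ ?_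
  · intro u _ v _ huv
    rw [Set.disjoint_left]
    rintro e (⟨rfl, rfl⟩ | ⟨rfl, rfl⟩ | ⟨rfl, rfl⟩) h' <;>
      simp only [Set.mem_ofPred_eq, Sym2.eq_iff] at h' <;> grind
  · intro v hv
    simp only [Finset.mem_insert, Finset.mem_singleton, not_or] at hv
    have build : ∀ {b c d e f : V} (h₁ : G.Adj v b) (h₂ : G.Adj c d) (h₃ : G.Adj e f),
        (c = v ∨ c = b) → (e = v ∨ e = b ∨ e = d) →
        ({v, b} ∪ {c, d} ∪ {e, f} : Set V) = {v, x, y, z} →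
        (∀ g : Sym2 V, g = s(c, d) ∨ g = s(e, f) → v ∈ g ∨
          (g = s(x, y) ∧ v = p ∨ g = s(y, z) ∧ v = q ∨ g = s(x, z) ∧ v = r)) →
        ∃ H : G.Subgraph, H.Connected ∧
          H.verts = insert v ((({x, y, z} : Finset V) : Set V)) ∧
          ∀ g ∈ H.edgeSet, v ∈ g ∨
            (g = s(x, y) ∧ v = p ∨ g = s(y, z) ∧ v = q ∨ g = s(x, z) ∧ v = r) := by
      intro b c d e f h₁ h₂ h₃ hc he hverts hedge
      refine ⟨_, connected_sup_subgraphOfAdj h₁ h₂ h₃ hc he, by simpa using hverts, ?_⟩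
      intro g hg
      simp only [Subgraph.edgeSet_sup, edgeSet_subgraphOfAdj, Set.mem_union,
        Set.mem_singleton_iff] at hg
      rcases hg with (rfl | hg) | hg
      · exact Or.inl (Sym2.mem_mk_left _ _)
      · exact hedge g (Or.inl hg)
      · exact hedge g (Or.inr hg)
    rcases h v hv.1 hv.2.1 hv.2.2 with ⟨h₁, h₂, h₃⟩ | ⟨rfl, h₁, h₂, h₃ | h₃⟩ |
      ⟨rfl, h₁, h₂, h₃ | h₃⟩ | ⟨rfl, h₁, h₂, h₃ | h₃⟩ | ⟨rfl, rfl, h₁, h₂, h₃⟩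
    on_goal 1 => refine build h₁ h₂ h₃ ?_ ?_ ?_ ?_
    on_goal 5 => refine build h₂ h₃ h₁ ?_ ?_ ?_ ?_
    on_goal 9 => refine build h₂ h₃ h₁.symm ?_ ?_ ?_ ?_
    on_goal 13 => refine build h₂ h₃ h₁ ?_ ?_ ?_ ?_
    on_goal 17 => refine build h₂ h₃ h₁.symm ?_ ?_ ?_ ?_
    on_goal 21 => refine build h₂ h₃ h₁ ?_ ?_ ?_ ?_
    on_goal 25 => refine build h₂ h₃ h₁.symm ?_ ?_ ?_ ?_
    on_goal 29 => refine build h₃ h₂.symm h₁.symm ?_ ?_ ?_ ?_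
    all_goals first
      | simp; done
      | (ext w; simp only [Set.mem_union, Set.mem_insert_iff, Set.mem_singleton_iff]; grind)

/-- A family of internally disjoint `S`-trees has at most as many members as there are neighbours
of any given vertex of `S`, provided `S` has another vertex. -/
theorem IsInternallyDisjointSTrees.le_degree {V : Type*} {G : SimpleGraph V}
    {S : Set V} {r : ℕ} {T : Fin r → G.Subgraph} (hT : IsInternallyDisjointSTrees G S T)
    {u v : V} (hu : u ∈ S) (hv : v ∈ S) (huv : u ≠ v) [Fintype (G.neighborSet u)] :
    r ≤ G.degree u := by
  have hadj : ∀ i, ∃ w, (T i).Adj u w := by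
    intro i
    have hc := (hT.1 i).2.connected.preconnected
    have : Nontrivial (T i).verts :=
      ⟨⟨u, (hT.1 i).1 hu⟩, ⟨v, (hT.1 i).1 hv⟩, fun h => huv (congrArg Subtype.val h)⟩
    obtain ⟨w, hw⟩ := hc.exists_adj_of_nontrivial ⟨u, (hT.1 i).1 hu⟩
    exact ⟨w, hw⟩
  choose w hw using hadj
  have hinj : Function.Injective w := by
    intro i j hij
    by_contra hne
    refine Set.disjoint_left.1 (hT.2 hne).1 (show s(u, w i) ∈ _ from hw i) ?_
    rw [hij]
    exact hw j
  rw [← card_neighborFinset_eq_degree, ← Finset.card_fin r]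
  exact Finset.card_le_card_of_injOn w
    (fun i _ => by simpa using (T i).adj_sub (hw i)) hinj.injOn

/-- For `M` the disjoint union of a path `a - b - c` and an edge `d - e`, every three vertices of
`K_n \ M` are joined by `n - 3` internally disjoint trees. -/
theorem exists_isInternallyDisjointSTrees_p3_union_p2 {V : Type*} [Fintype V] [DecidableEq V]
    {a b c d e : V} (hnd : [a, b, c, d, e].Nodup) {S : Finset V} (hS : S.card = 3) :
    ∃ T : Fin (Fintype.card V - 3) →
        ((⊤ : SimpleGraph V).deleteEdges {s(a, b), s(b, c), s(d, e)}).Subgraph,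
      IsInternallyDisjointSTrees _ (S : Set V) T := by
  set G := (⊤ : SimpleGraph V).deleteEdges {s(a, b), s(b, c), s(d, e)}
  have hadj : ∀ u v, G.Adj u v ↔ u ≠ v ∧ ¬ (u = a ∧ v = b) ∧ ¬ (u = b ∧ v = a) ∧
      ¬ (u = b ∧ v = c) ∧ ¬ (u = c ∧ v = b) ∧ ¬ (u = d ∧ v = e) ∧ ¬ (u = e ∧ v = d) := by
    intro u v
    simp only [G, deleteEdges_adj, top_adj, Set.mem_insert_iff, Set.mem_singleton_iff, Sym2.eq_iff]
    tauto
  simp only [List.nodup_cons, List.mem_cons, List.not_mem_nil, or_false, not_or, not_false_eq_true,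
    List.nodup_nil, and_true] at hnd
  have split₁ : ∀ u ∈ S, ∃ y z, u ≠ y ∧ y ≠ z ∧ u ≠ z ∧ S = {u, y, z} := by
    intro u hu
    have h2 : (S.erase u).card = 2 := by rw [Finset.card_erase_of_mem hu, hS]
    obtain ⟨y, z, hyz, h⟩ := Finset.card_eq_two.1 h2
    have hy : y ∈ S.erase u := by simp [h]
    have hz : z ∈ S.erase u := by simp [h]
    refine ⟨y, z, (Finset.ne_of_mem_erase hy).symm, hyz, (Finset.ne_of_mem_erase hz).symm, ?_⟩
    rw [← h, Finset.insert_erase hu]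
  have split₂ : ∀ u ∈ S, ∀ w ∈ S, u ≠ w → ∃ z, w ≠ z ∧ u ≠ z ∧ S = {u, w, z} := by
    intro u hu w hw huw
    obtain ⟨y, z, huy, hyz, huz, rfl⟩ := split₁ u hu
    simp only [Finset.mem_insert, Finset.mem_singleton] at hw
    rcases hw with rfl | rfl | rfl
    · exact absurd rfl huw
    · exact ⟨z, hyz, huz, rfl⟩
    · exact ⟨y, hyz.symm, huy, by rw [Finset.pair_comm]⟩
  by_cases hb : b ∈ S
  · by_cases ha : a ∈ S
    · obtain ⟨w, hbw, haw, rfl⟩ := split₂ a ha b hb (by tauto)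
      refine exists_isInternallyDisjointSTrees_triple (by tauto) hbw haw a c
        (if w = d then e else d) fun v hx hy hz => ?_
      simp only [hadj]
      simp only [Finset.mem_insert, Finset.mem_singleton] at *
      grind
    by_cases hc : c ∈ S
    · obtain ⟨w, hbw, hcw, rfl⟩ := split₂ c hc b hb (by tauto)
      refine exists_isInternallyDisjointSTrees_triple (by tauto) hbw hcw a a
        (if w = d then e else d) fun v hx hy hz => ?_
      simp only [hadj]
      simp only [Finset.mem_insert, Finset.mem_singleton] at *
      grind
    · obtain ⟨y, z, hby, hyz, hbz, rfl⟩ := split₁ b hb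
      refine exists_isInternallyDisjointSTrees_triple hby hyz hbz a
        (if y = d ∨ z = d then e else d) c fun v hx hy hz => ?_
      simp only [hadj]
      simp only [Finset.mem_insert, Finset.mem_singleton] at *
      grind
  by_cases ha : a ∈ S
  · by_cases hc : c ∈ S
    · obtain ⟨w, hcw, haw, rfl⟩ := split₂ a ha c hc (by tauto)
      refine exists_isInternallyDisjointSTrees_triple (by tauto) hcw haw b b
        (if w = d then e else d) fun v hx hy hz => ?_
      simp only [hadj]
      simp only [Finset.mem_insert, Finset.mem_singleton] at *
      grind
    · obtain ⟨y, z, hay, hyz, haz, rfl⟩ := split₁ a ha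
      refine exists_isInternallyDisjointSTrees_triple hay hyz haz b
        (if y = d ∨ z = d then e else d) b fun v hx hy hz => ?_
      simp only [hadj]
      simp only [Finset.mem_insert, Finset.mem_singleton] at *
      grind
  by_cases hc : c ∈ S
  · obtain ⟨y, z, hcy, hyz, hcz, rfl⟩ := split₁ c hc
    refine exists_isInternallyDisjointSTrees_triple hcy hyz hcz b
      (if y = d ∨ z = d then e else d) b fun v hx hy hz => ?_
    simp only [hadj]
    simp only [Finset.mem_insert, Finset.mem_singleton] at *
    grind
  by_cases hd : d ∈ S
  · obtain ⟨y, z, hdy, hyz, hdz, rfl⟩ := split₁ d hd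
    refine exists_isInternallyDisjointSTrees_triple hdy hyz hdz e e e fun v hx hy hz => ?_
    simp only [hadj]
    simp only [Finset.mem_insert, Finset.mem_singleton] at *
    grind
  · obtain ⟨x, y, z, hxy, hxz, hyz, rfl⟩ := Finset.card_eq_three.1 hS
    refine exists_isInternallyDisjointSTrees_triple hxy hyz hxz d d d fun v hx hy hz => ?_
    simp only [hadj]
    simp only [Finset.mem_insert, Finset.mem_singleton] at *
    grind

theorem genConn_three_delete_p3_union_p2 (n : ℕ) (hn : 5 ≤ n) (M : Set (Sym2 (Fin n)))
    (hshape : IsP3UnionP2Edges M) :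
    genConn ((⊤ : SimpleGraph (Fin n)).deleteEdges M) 3 = n - 3 := by
  classical
  obtain ⟨a, b, c, d, e, hnd, rfl⟩ := hshape
  refine IsGreatest.csSup_eq ⟨⟨by omega, fun S hS => ?_⟩, ?_⟩
  · have h := exists_isInternallyDisjointSTrees_p3_union_p2 hnd hS
    rwa [Fintype.card_fin] at h
  rintro r ⟨-, hr⟩
  simp only [List.nodup_cons, List.mem_cons, List.not_mem_nil, or_false, not_or, not_false_eq_true,
    List.nodup_nil, and_true] at hnd
  obtain ⟨T, hT⟩ := hr {a, b, c}
    (Finset.card_eq_three.2 ⟨a, b, c, by tauto, by tauto, by tauto, rfl⟩)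
  refine (hT.le_degree (u := b) (v := a) (by simp) (by simp) (by tauto)).trans ?_
  have hsub : ((⊤ : SimpleGraph (Fin n)).deleteEdges {s(a, b), s(b, c), s(d, e)}).neighborFinset b
      ⊆ ({a, b, c} : Finset (Fin n))ᶜ := by
    intro v hv
    simp only [mem_neighborFinset, deleteEdges_adj, top_adj, Set.mem_insert_iff,
      Set.mem_singleton_iff, Sym2.eq_iff] at hv
    simp only [Finset.mem_compl, Finset.mem_insert, Finset.mem_singleton]
    grind
  refine (Finset.card_le_card hsub).trans_eq ?_
  rw [Finset.card_compl, Fintype.card_fin,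
    Finset.card_eq_three.2 ⟨a, b, c, by tauto, by tauto, by tauto, rfl⟩]
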